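/- Let n ≥ 1, S ≥ 1 and g ≥ 1 be natural numbers, and let v_1 < v_2 < ⋯ < v_n be natural numbers such that v_{i+1} − v_i ≤ g for all 1 ≤ i < n. Then the number of distinct values among ⌊v_1/S⌋, ⌊v_2/S⌋, …, ⌊v_n/S⌋ is at most (n − 1)·g/S + 2 (as an inequality of real numbers). -/

import Mathlib

/-- The number of aligned length-`S` blocks meeting `[a, a + L]` is at most `L / S + 2`. -/
lemma card_Icc_div_le (a L S : ℕ) (hS : 1 ≤ S) :
    ((Finset.Icc (a / S) ((a + L) / S)).card : ℝ) ≤ (L : ℝ) / S + 2 := by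
  have hS' : (0 : ℝ) < S := by exact_mod_cast hS
  have hle : a / S ≤ (a + L) / S := Nat.div_le_div_right (Nat.le_add_right a L)
  have hupper : S * ((a + L) / S) ≤ a + L := Nat.mul_div_le _ _
  have hlower : a < S * (a / S + 1) := Nat.lt_mul_div_succ a hS
  obtain ⟨d, hd⟩ := Nat.exists_eq_add_of_le hle
  have hcard : (Finset.Icc (a / S) ((a + L) / S)).card = d + 1 := by
    rw [Nat.card_Icc, hd]
    omega
  have hdS : d * S ≤ L + S := by
    rw [hd] at hupper
    nlinarith
  have hdiv : (d : ℝ) ≤ (L + S) / S := by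
    rw [le_div_iff₀ hS']
    exact_mod_cast hdS
  rw [add_div, div_self hS'.ne'] at hdiv
  rw [hcard]
  push_cast
  linarith

/-- A sequence increasing on `[1, n]` with gaps at most `g` stays in `[v 1, v 1 + k * g]` for
`k` steps. -/
lemma le_and_le_add_mul_of_gap_le {n g : ℕ} {v : ℕ → ℕ}
    (hmono : ∀ i, 1 ≤ i → i < n → v i < v (i + 1))
    (hgap : ∀ i, 1 ≤ i → i < n → v (i + 1) - v i ≤ g) (k : ℕ) (hk : k + 1 ≤ n) :
    v 1 ≤ v (k + 1) ∧ v (k + 1) ≤ v 1 + k * g := by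
  induction k with
  | zero => simp
  | succ k ih =>
    have hprev := ih (by omega)
    have hlt := hmono (k + 1) (by omega) (by omega)
    have hstep := hgap (k + 1) (by omega) (by omega)
    rw [add_mul, one_mul]
    omega

/-- Let `v 1 < v 2 < ⋯ < v n` be naturals with adjacent gaps at most `g`, and let
`S ≥ 1`.  Then the number of distinct values among `⌊v 1 / S⌋, …, ⌊v n / S⌋` — i.e. the
number of aligned length-`S` blocks occupied by the `v i` — is at most
`(n - 1)·g/S + 2` as real numbers. -/
theorem occupied_blocks_le (n S g : ℕ) (hn : 1 ≤ n) (hS : 1 ≤ S) (hg : 1 ≤ g)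
    (v : ℕ → ℕ) (hmono : ∀ i, 1 ≤ i → i < n → v i < v (i + 1))
    (hgap : ∀ i, 1 ≤ i → i < n → v (i + 1) - v i ≤ g) :
    (((Finset.Icc 1 n).image (fun i => v i / S)).card : ℝ) ≤
      ((n : ℝ) - 1) * g / S + 2 := by
  obtain ⟨m, rfl⟩ := Nat.exists_eq_add_of_le' hn
  have hsub : (Finset.Icc 1 (m + 1)).image (fun i => v i / S) ⊆
      Finset.Icc (v 1 / S) ((v 1 + m * g) / S) := by
    intro x hx
    obtain ⟨i, hi, rfl⟩ := Finset.mem_image.mp hx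
    obtain ⟨hi1, him⟩ := Finset.mem_Icc.mp hi
    obtain ⟨k, rfl⟩ := Nat.exists_eq_add_of_le' hi1
    obtain ⟨hlow, hup⟩ := le_and_le_add_mul_of_gap_le hmono hgap k him
    have hkm : k * g ≤ m * g := Nat.mul_le_mul_right g (by omega)
    exact Finset.mem_Icc.mpr
      ⟨Nat.div_le_div_right hlow, Nat.div_le_div_right (by omega)⟩
  calc (((Finset.Icc 1 (m + 1)).image (fun i => v i / S)).card : ℝ)
      ≤ ((Finset.Icc (v 1 / S) ((v 1 + m * g) / S)).card : ℝ) := by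
        exact_mod_cast Finset.card_le_card hsub
    _ ≤ ((m * g : ℕ) : ℝ) / S + 2 := card_Icc_div_le _ _ _ hS
    _ = (((m + 1 : ℕ) : ℝ) - 1) * g / S + 2 := by
        push_cast
        ring
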